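/- arXiv:2506.20261 — 4 statements merged into one kernel-verified Lean document; each statement's English description precedes it below -/
import Mathlib

section
/- Let U be a Geometric(p) random variable on ℕ₊ with p ∈ (0,1). Then E[log U] = ∫_0^∞ e^{−t} · ( (1−p)(1−e^{−t}) ) / ( t · (1 − (1−p) e^{−t}) ) dt. -/
open MeasureTheory

/-- The expected logarithm `E[log U]` of a Geometric(p) random variable `U` on `ℕ₊`,
`P[U = u] = (1-p)^(u-1) p`: here `u = j+1`, `j : ℕ`. -/
noncomputable def geomLogMean (p : ℝ) : ℝ :=
  ∑' j : ℕ, p * (1 - p) ^ j * Real.log (j + 1)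

theorem integrableOn_inv_mul_exp_sub_exp {b : ℝ} (hb : 1 ≤ b) :
    IntegrableOn (fun t : ℝ ↦ t⁻¹ * (Real.exp (-t) - Real.exp (-(b * t)))) (Set.Ioi 0) := by
  refine ((integrableOn_exp_neg_Ioi 0).const_mul (b - 1)).mono'
    (by fun_prop) ((ae_restrict_iff' measurableSet_Ioi).2 (.of_forall fun t ht ↦ ?_))
  have ht : 0 < t := ht
  have hle : Real.exp (-(b * t)) ≤ Real.exp (-t) := Real.exp_le_exp.2 (by nlinarith)
  rw [Real.norm_of_nonneg (mul_nonneg (inv_nonneg.2 ht.le) (sub_nonneg.2 hle)),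
    inv_mul_le_iff₀ ht]
  have hsplit : Real.exp (-(b * t)) = Real.exp (-t) * Real.exp (-((b - 1) * t)) := by
    rw [← Real.exp_add]; ring_nf
  rw [hsplit]
  nlinarith [mul_le_mul_of_nonneg_left (Real.add_one_le_exp (-((b - 1) * t)))
    (Real.exp_pos (-t)).le]

theorem integral_inv_mul_exp_sub_exp {b : ℝ} (hb : 1 ≤ b) :
    ∫ t in Set.Ioi (0 : ℝ), t⁻¹ * (Real.exp (-t) - Real.exp (-(b * t))) = Real.log b := by
  have hcont : Continuous fun t : ℝ ↦ Real.exp (-t) := by fun_prop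
  have hzero : Filter.Tendsto (fun t : ℝ ↦ Real.exp (-t)) (nhdsWithin 0 (Set.Ioi 0)) (nhds 1) := by
    simpa using (hcont.tendsto 0).mono_left nhdsWithin_le_nhds
  have h := Frullani.integral_Ioi_eq (hcont.locallyIntegrable.locallyIntegrableOn _)
    one_pos (one_pos.trans_le hb) hzero Real.tendsto_exp_neg_atTop_nhds_zero
    (by simpa using integrableOn_inv_mul_exp_sub_exp hb)
  simpa using h

theorem hasSum_geometric_mul_exp_sub_exp {p t : ℝ} (hp : p ∈ Set.Ioo (0 : ℝ) 1) (ht : 0 < t) :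
    HasSum (fun j : ℕ ↦
        p * (1 - p) ^ j * (t⁻¹ * (Real.exp (-t) - Real.exp (-(((j : ℝ) + 1) * t)))))
      (Real.exp (-t) * ((1 - p) * (1 - Real.exp (-t)))
        / (t * (1 - (1 - p) * Real.exp (-t)))) := by
  obtain ⟨hp0, hp1⟩ := hp
  have he : Real.exp (-t) < 1 := by simpa using ht
  have he0 := Real.exp_pos (-t)
  have hlt : (1 - p) * Real.exp (-t) < 1 := by nlinarith
  have h₁ := (hasSum_geometric_of_lt_one (sub_nonneg.2 hp1.le) (by linarith : 1 - p < 1)).mul_left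
    (p * t⁻¹ * Real.exp (-t))
  have h₂ := (hasSum_geometric_of_lt_one
    (mul_nonneg (sub_nonneg.2 hp1.le) he0.le) hlt).mul_left (p * t⁻¹ * Real.exp (-t))
  convert! h₁.sub h₂ using 1
  · ext j
    have hexp : Real.exp (-(((j : ℝ) + 1) * t)) = Real.exp (-t) * Real.exp (-t) ^ j := by
      rw [← Real.exp_nat_mul, ← Real.exp_add]; ring_nf
    rw [hexp, mul_pow]
    ring
  · have hne : 1 - Real.exp (-t) * (1 - p) ≠ 0 := by linarith
    rw [sub_sub_cancel, mul_comm (1 - p) (Real.exp (-t))]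
    field_simp
    ring

/-- for a Geometric(p) random variable `U` on `ℕ₊` with `p ∈ (0,1)`,
`E[log U] = ∫_0^∞ e^{−t} (1−p)(1−e^{−t}) / ( t (1 − (1−p) e^{−t}) ) dt`. -/
theorem stmt7 (p : ℝ) (hp : p ∈ Set.Ioo (0:ℝ) 1) :
    geomLogMean p
      = ∫ t in Set.Ioi (0:ℝ),
          Real.exp (-t) * ((1 - p) * (1 - Real.exp (-t)))
            / (t * (1 - (1 - p) * Real.exp (-t))) := by
  have hq0 : 0 ≤ 1 - p := sub_nonneg.2 hp.2.le
  have hone (j : ℕ) : (1 : ℝ) ≤ j + 1 := by simp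
  set F : ℕ → ℝ → ℝ := fun j t ↦
    p * (1 - p) ^ j * (t⁻¹ * (Real.exp (-t) - Real.exp (-(((j : ℝ) + 1) * t)))) with hF
  have hint (j : ℕ) : IntegrableOn (F j) (Set.Ioi 0) :=
    (integrableOn_inv_mul_exp_sub_exp (hone j)).const_mul _
  have hval (j : ℕ) : ∫ t in Set.Ioi (0 : ℝ), F j t = p * (1 - p) ^ j * Real.log (j + 1) := by
    rw [hF, integral_const_mul, integral_inv_mul_exp_sub_exp (hone j)]
  have hnorm (j : ℕ) : ∫ t in Set.Ioi (0 : ℝ), ‖F j t‖ = p * (1 - p) ^ j * Real.log (j + 1) := by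
    rw [← hval]
    refine setIntegral_congr_fun measurableSet_Ioi fun t ht ↦ Real.norm_of_nonneg ?_
    have ht : 0 < t := ht
    have hle : Real.exp (-(((j : ℝ) + 1) * t)) ≤ Real.exp (-t) :=
      Real.exp_le_exp.2 (by nlinarith [hone j])
    exact mul_nonneg (mul_nonneg hp.1.le (pow_nonneg hq0 j))
      (mul_nonneg (inv_nonneg.2 ht.le) (sub_nonneg.2 hle))
  have hsum : Summable fun j : ℕ ↦ p * (1 - p) ^ j * Real.log (j + 1) := by
    have hq : ‖1 - p‖ < 1 := by rw [Real.norm_of_nonneg hq0]; linarith [hp.1]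
    refine .of_nonneg_of_le (fun j ↦ ?_) (fun j ↦ ?_)
      ((hasSum_coe_mul_geometric_of_norm_lt_one hq).summable.mul_left p)
    · exact mul_nonneg (mul_nonneg hp.1.le (pow_nonneg hq0 j)) (Real.log_nonneg (hone j))
    · have hlog : Real.log (j + 1) ≤ j := by
        linarith [Real.log_le_sub_one_of_pos (one_pos.trans_le (hone j))]
      calc p * (1 - p) ^ j * Real.log (j + 1) ≤ p * (1 - p) ^ j * j :=
            mul_le_mul_of_nonneg_left hlog (mul_nonneg hp.1.le (pow_nonneg hq0 j))
        _ = p * (j * (1 - p) ^ j) := by ring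
  have hswap := hasSum_integral_of_summable_integral_norm hint (by simpa only [hnorm] using hsum)
  simp only [hval] at hswap
  rw [geomLogMean, hswap.tsum_eq]
  exact setIntegral_congr_fun measurableSet_Ioi fun t ht ↦
    (hasSum_geometric_mul_exp_sub_exp hp ht).tsum_eq
end

section
/- Let p₁, p₂ ∈ (0,1] and let U₁ ∼ Geometric(p₁) and U₂ ∼ Geometric(p₂) be geometric random variables on ℕ₊. Then | E[log U₁] − E[log U₂] | ≤ | log p₁ − log p₂ |. -/
open MeasureTheory

/-- Summation by parts: `E[log U] = ∑ P[U > u] (log (u + 1) - log u)`. -/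
theorem hasSum_geomLogMean {p : ℝ} (hp : p ∈ Set.Ioc (0 : ℝ) 1) :
    HasSum (fun n : ℕ => (1 - p) ^ (n + 1) * (Real.log (n + 2) - Real.log (n + 1)))
      (geomLogMean p) := by
  have hq0 : 0 ≤ 1 - p := by linarith [hp.2]
  have hq1 : 1 - p < 1 := by linarith [hp.1]
  have hs : Summable (fun j : ℕ => (1 - p) ^ j * Real.log (j + 1)) := by
    have hmaj := summable_pow_mul_geometric_of_norm_lt_one (R := ℝ) 1
      (show ‖1 - p‖ < 1 by rwa [Real.norm_of_nonneg hq0])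
    refine Summable.of_nonneg_of_le (fun j => ?_) (fun j => ?_) hmaj
    · exact mul_nonneg (pow_nonneg hq0 j) (Real.log_nonneg (by simp))
    · have hlog := Real.log_le_sub_one_of_pos (show (0 : ℝ) < j + 1 by positivity)
      rw [pow_one, mul_comm]
      exact mul_le_mul_of_nonneg_right (by linarith) (pow_nonneg hq0 j)
  have hshift := (hasSum_nat_add_iff' 1).mpr hs.hasSum
  have hdiff := hshift.sub (hs.hasSum.mul_left (1 - p))
  have hsum : geomLogMean p = ∑' j : ℕ, (1 - p) ^ j * Real.log (j + 1)
      - ∑ j ∈ Finset.range 1, (1 - p) ^ j * Real.log (j + 1)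
      - (1 - p) * ∑' j : ℕ, (1 - p) ^ j * Real.log (j + 1) := by
    simp only [geomLogMean, mul_assoc, tsum_mul_left, Finset.sum_range_one, Nat.cast_zero,
      zero_add, Real.log_one, mul_zero]
    ring
  rw [hsum]
  refine (congrArg (HasSum · _) (funext fun n => ?_)).mp hdiff
  push_cast
  rw [add_assoc (n : ℝ) 1 1, one_add_one_eq_two]
  ring

theorem geomLogMean_anti {p q : ℝ} (hp : p ∈ Set.Ioc (0 : ℝ) 1) (hq : q ∈ Set.Ioc (0 : ℝ) 1)
    (hpq : p ≤ q) : geomLogMean q ≤ geomLogMean p := by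
  refine hasSum_le (fun n => ?_) (hasSum_geomLogMean hq) (hasSum_geomLogMean hp)
  have hlog : Real.log ((n : ℝ) + 1) ≤ Real.log (n + 2) :=
    Real.log_le_log (by positivity) (by linarith)
  exact mul_le_mul_of_nonneg_right
    (pow_le_pow_left₀ (by linarith [hq.2]) (by linarith) _) (by linarith)

theorem geomLogMean_add_log_mono {p q : ℝ} (hp : p ∈ Set.Ioc (0 : ℝ) 1)
    (hq : q ∈ Set.Ioc (0 : ℝ) 1) (hpq : p ≤ q) :
    geomLogMean p + Real.log p ≤ geomLogMean q + Real.log q := by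
  have hasSum_log {r : ℝ} (hr : r ∈ Set.Ioc (0 : ℝ) 1) :
      HasSum (fun n : ℕ => (1 - r) ^ (n + 1) / ((n : ℝ) + 1)) (-Real.log r) := by
    have habs : |1 - r| < 1 := by
      rw [abs_lt]
      constructor <;> linarith [hr.1, hr.2]
    simpa using Real.hasSum_pow_div_log_of_abs_lt_one habs
  have key := hasSum_le (fun n => ?_) ((hasSum_log hq).sub (hasSum_geomLogMean hq))
    ((hasSum_log hp).sub (hasSum_geomLogMean hp))
  · linarith
  · have hn : (0 : ℝ) < n + 1 := by positivity
    have hlog : Real.log ((n : ℝ) + 2) - Real.log (n + 1) ≤ 1 / (n + 1) := by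
      rw [← Real.log_div (by positivity) hn.ne']
      refine (Real.log_le_sub_one_of_pos (by positivity)).trans_eq ?_
      field_simp
      ring
    have hpow : (1 - q) ^ (n + 1) ≤ (1 - p) ^ (n + 1) :=
      pow_le_pow_left₀ (by linarith [hq.2]) (by linarith) _
    have hmul := mul_le_mul_of_nonneg_right hpow (sub_nonneg.mpr hlog)
    simpa only [mul_sub, mul_one_div] using hmul

/-- if `U₁ ∼ Geometric(p₁)` and `U₂ ∼ Geometric(p₂)` on `ℕ₊`, with
`p₁, p₂ ∈ (0,1]`, then `|E[log U₁] − E[log U₂]| ≤ |log p₁ − log p₂|`. -/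
theorem stmt8 (p₁ p₂ : ℝ) (hp₁ : p₁ ∈ Set.Ioc (0:ℝ) 1) (hp₂ : p₂ ∈ Set.Ioc (0:ℝ) 1) :
    |geomLogMean p₁ - geomLogMean p₂| ≤ |Real.log p₁ - Real.log p₂| := by
  wlog hle : p₁ ≤ p₂ generalizing p₁ p₂
  · rw [abs_sub_comm, abs_sub_comm (Real.log p₁)]
    exact this p₂ p₁ hp₂ hp₁ (le_of_not_ge hle)
  have hanti := geomLogMean_anti hp₁ hp₂ hle
  have hmono := geomLogMean_add_log_mono hp₁ hp₂ hle
  rw [abs_of_nonneg (sub_nonneg.mpr hanti), abs_sub_comm]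
  exact le_trans (by linarith) (le_abs_self _)
end

section
/- Let 𝒳 and 𝒴 be finite alphabets, P_X a source distribution on 𝒳, ρ : 𝒳 × 𝒴 → ℝ a distortion measure and d a distortion level such that for every x ∈ 𝒳 there exists y ∈ 𝒴 with ρ(x,y) ≤ d. Let ε > 0 and η ∈ (0,1), and let 𝒫^{(η)}(𝒴) := { Q probability distribution on 𝒴 : Q(y) ≥ η for all y ∈ 𝒴 }. Then there exists a finite set {Q⋆^{(1)}, …, Q⋆^{(k)}} of probability distributions on 𝒴 of cardinality k ≤ ( (1/(ηε)) · √( max_{x∈𝒳} Σ_{y∈𝒴} 1{ρ(x,y) ≤ d} ) )^{|𝒴|−1} (rounded up to an integer) such that for every Q ∈ 𝒫^{(η)}(𝒴) there is an index a ∈ [k] with | b̃(Q) − b̃(Q⋆^{(a)}) | ≤ ε, where b̃(Q) := E_{X∼P_X, 𝒞∼Q^{⊗∞}}[ log J(X,𝒞) ]. -/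
open Finset

/-- The `d`-match probability `p(x,Q) = ∑_{y : ρ(x,y) ≤ d} Q(y)` of a probability
vector `Q` on a finite alphabet `𝒴`. -/
noncomputable def matchProbVec {𝒳 𝒴 : Type*} [Fintype 𝒴]
    (ρ : 𝒳 → 𝒴 → ℝ) (d : ℝ) (Q : 𝒴 → ℝ) (x : 𝒳) : ℝ :=
  ∑ y ∈ Finset.univ.filter (fun y => ρ x y ≤ d), Q y

/-- The mean cost `b̃(Q) = E_{X∼PX,𝒞∼Q^⊗∞}[log J(X,𝒞)] = ∑_x PX(x)·g(p(x,Q))`,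
`g(p)` being the expected log of a Geometric(p) variable. -/
noncomputable def meanCostVec {𝒳 𝒴 : Type*} [Fintype 𝒳] [Fintype 𝒴]
    (PX : 𝒳 → ℝ) (ρ : 𝒳 → 𝒴 → ℝ) (d : ℝ) (Q : 𝒴 → ℝ) : ℝ :=
  ∑ x, PX x * geomLogMean (matchProbVec ρ d Q x)

lemma geomLogMean_nonneg {p : ℝ} (hp : 0 < p) (hp1 : p ≤ 1) : 0 ≤ geomLogMean p :=
  tsum_nonneg fun j => mul_nonneg (mul_nonneg hp.le (pow_nonneg (by linarith) j))
    (Real.log_nonneg (by linarith [(Nat.cast_nonneg j : (0 : ℝ) ≤ j)]))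

lemma geomLogMean_le_inv {p : ℝ} (hp : 0 < p) (hp1 : p ≤ 1) : geomLogMean p ≤ p⁻¹ := by
  have hr : ‖1 - p‖ < 1 := by
    rw [Real.norm_eq_abs, abs_lt]
    constructor <;> linarith
  have hs := (hasSum_coe_mul_geometric_of_norm_lt_one hr).mul_left p
  have hle : ∀ j : ℕ, p * (1 - p) ^ j * Real.log (j + 1) ≤ p * (j * (1 - p) ^ j) := by
    intro j
    have hj : (0 : ℝ) ≤ j := Nat.cast_nonneg j
    have hlog : Real.log (j + 1) ≤ j := by
      linarith [Real.log_le_sub_one_of_pos (show (0 : ℝ) < j + 1 by linarith)]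
    have := mul_le_mul_of_nonneg_left hlog
      (mul_nonneg hp.le (pow_nonneg (by linarith : 0 ≤ 1 - p) j))
    linarith
  have hnonneg : ∀ j : ℕ, 0 ≤ p * (1 - p) ^ j * Real.log (j + 1) := fun j =>
    mul_nonneg (mul_nonneg hp.le (pow_nonneg (by linarith) j))
      (Real.log_nonneg (by linarith [(Nat.cast_nonneg j : (0 : ℝ) ≤ j)]))
  calc geomLogMean p ≤ p * ((1 - p) / (1 - (1 - p)) ^ 2) :=
        ((Summable.of_nonneg_of_le hnonneg hle hs.summable).tsum_le_tsum hle
          hs.summable).trans_eq hs.tsum_eq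
    _ = (1 - p) * p⁻¹ := by
        rw [sub_sub_cancel]
        field_simp
    _ ≤ p⁻¹ := mul_le_of_le_one_left (inv_nonneg.2 hp.le) (by linarith)

lemma meanCostVec_mem_Icc {𝒳 𝒴 : Type*} [Fintype 𝒳] [Fintype 𝒴]
    {PX : 𝒳 → ℝ} (hPX : ∀ x, 0 ≤ PX x) (hPX1 : ∑ x, PX x = 1)
    {ρ : 𝒳 → 𝒴 → ℝ} {d : ℝ} (hmatch : ∀ x, ∃ y, ρ x y ≤ d) {η : ℝ} (hη : 0 < η)
    {Q : 𝒴 → ℝ} (hQ : ∀ y, η ≤ Q y) (hQ1 : ∑ y, Q y = 1) :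
    meanCostVec PX ρ d Q ∈ Set.Icc 0 η⁻¹ := by
  have hQ0 : ∀ y, 0 ≤ Q y := fun y => hη.le.trans (hQ y)
  have hlow : ∀ x, η ≤ matchProbVec ρ d Q x := by
    intro x
    obtain ⟨y, hy⟩ := hmatch x
    exact (hQ y).trans (single_le_sum (fun z _ => hQ0 z) (by simpa using hy))
  have hup : ∀ x, matchProbVec ρ d Q x ≤ 1 := fun x =>
    (sum_le_sum_of_subset_of_nonneg (filter_subset _ _) fun z _ _ => hQ0 z).trans_eq hQ1
  have hpos : ∀ x, 0 < matchProbVec ρ d Q x := fun x => hη.trans_le (hlow x)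
  refine ⟨sum_nonneg fun x _ => mul_nonneg (hPX x) (geomLogMean_nonneg (hpos x) (hup x)), ?_⟩
  calc meanCostVec PX ρ d Q ≤ ∑ x, PX x * η⁻¹ := sum_le_sum fun x _ =>
        mul_le_mul_of_nonneg_left ((geomLogMean_le_inv (hpos x) (hup x)).trans
          (inv_anti₀ hη (hlow x))) (hPX x)
    _ = η⁻¹ := by rw [← sum_mul, hPX1, one_mul]

/-- A real function with values in `[0, K * ε]` on a nonempty set `S` is determined on `S`
up to `ε` by its values at `K` points of `S`. -/
lemma exists_net_of_bounded {α : Type*} {S : Set α} (hS : S.Nonempty) (f : α → ℝ)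
    {ε : ℝ} (hε : 0 < ε) {K : ℕ} (hK : 0 < K) (hf : ∀ a ∈ S, f a ∈ Set.Icc 0 (K * ε)) :
    ∃ q : Fin K → α, (∀ i, q i ∈ S) ∧ ∀ a ∈ S, ∃ i, |f a - f (q i)| ≤ ε := by
  classical
  obtain ⟨a₀, ha₀⟩ := hS
  let P : Fin K → α → Prop := fun i a => a ∈ S ∧ f a ∈ Set.Icc (i * ε) ((i + 1) * ε)
  refine ⟨fun i => if h : ∃ a, P i a then h.choose else a₀, fun i => ?_, fun a ha => ?_⟩
  · dsimp only
    split_ifs with h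
    · exact h.choose_spec.1
    · exact ha₀
  · obtain ⟨i, hi⟩ : ∃ i, P i a := by
      obtain ⟨h0, h1⟩ := hf a ha
      rcases h1.lt_or_eq with hlt | heq
      · refine ⟨⟨⌊f a / ε⌋₊, (Nat.floor_lt (by positivity)).2 ((div_lt_iff₀ hε).2 hlt)⟩,
          ha, ?_, ?_⟩
        · exact (le_div_iff₀ hε).1 (Nat.floor_le (by positivity))
        · exact (div_le_iff₀ hε).1 (Nat.lt_floor_add_one _).le
      · have hc : ((K - 1 : ℕ) : ℝ) + 1 = K := by exact_mod_cast Nat.sub_add_cancel hK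
        refine ⟨⟨K - 1, by omega⟩, ha, ?_, ?_⟩
        · rw [heq]
          exact mul_le_mul_of_nonneg_right (by dsimp only; linarith) hε.le
        · rw [heq]
          exact mul_le_mul_of_nonneg_right hc.ge hε.le
    have hex : ∃ b, P i b := ⟨a, hi⟩
    refine ⟨i, ?_⟩
    dsimp only
    rw [dif_pos hex, abs_le]
    obtain ⟨h1, h2⟩ := hi.2
    obtain ⟨h3, h4⟩ := hex.choose_spec.2
    constructor <;> linarith

/-- an `ε`-net for the mean cost on the restricted simplex
`𝒫^{(η)}(𝒴) = {Q : Q(y) ≥ η ∀y}`, of cardinality at most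
`⌈((1/(ηε))·√(max_x ∑_y 1{ρ(x,y)≤d}))^(|𝒴|−1)⌉`. -/
theorem stmt11 {𝒳 𝒴 : Type*} [Fintype 𝒳] [Nonempty 𝒳] [Fintype 𝒴] [Nonempty 𝒴]
    (PX : 𝒳 → ℝ) (hPX : ∀ x, 0 ≤ PX x) (hPX1 : ∑ x, PX x = 1)
    (ρ : 𝒳 → 𝒴 → ℝ) (d : ℝ)
    (hmatch : ∀ x, ∃ y, ρ x y ≤ d)
    (ε : ℝ) (hε : 0 < ε) (η : ℝ) (hη : η ∈ Set.Ioo (0:ℝ) 1) :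
    ∃ (k : ℕ) (Qs : Fin k → 𝒴 → ℝ),
      k ≤ ⌈((1 / (η * ε)) * Real.sqrt
            (((Finset.univ.sup fun x : 𝒳 =>
              (Finset.univ.filter fun y : 𝒴 => ρ x y ≤ d).card : ℕ) : ℝ)))
          ^ (Fintype.card 𝒴 - 1)⌉₊ ∧
      (∀ a, (∀ y, 0 ≤ Qs a y) ∧ ∑ y, Qs a y = 1) ∧
      ∀ Q : 𝒴 → ℝ, (∀ y, η ≤ Q y) → ∑ y, Q y = 1 →
        ∃ a, |meanCostVec PX ρ d Q - meanCostVec PX ρ d (Qs a)| ≤ ε := by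
  obtain ⟨hη0, -⟩ := hη
  set M : ℕ := Finset.univ.sup fun x : 𝒳 => (Finset.univ.filter fun y : 𝒴 => ρ x y ≤ d).card
  set t : ℝ := 1 / (η * ε) * Real.sqrt M
  let S : Set (𝒴 → ℝ) := {Q | (∀ y, η ≤ Q y) ∧ ∑ y, Q y = 1}
  rcases S.eq_empty_or_nonempty with hS | hS
  · exact ⟨0, fun a => a.elim0, Nat.zero_le _, fun a => a.elim0, fun Q h1 h2 =>
      absurd (show Q ∈ S from ⟨h1, h2⟩) (hS ▸ Set.notMem_empty Q)⟩
  have hM : 1 ≤ M := by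
    obtain ⟨x⟩ := ‹Nonempty 𝒳›
    obtain ⟨y, hy⟩ := hmatch x
    have hcard : 1 ≤ (Finset.univ.filter fun y : 𝒴 => ρ x y ≤ d).card :=
      card_pos.2 ⟨y, by simpa using hy⟩
    exact hcard.trans (le_sup (f := fun x : 𝒳 =>
      (Finset.univ.filter fun y : 𝒴 => ρ x y ≤ d).card) (mem_univ x))
  have hbase : 1 / (η * ε) ≤ t :=
    le_mul_of_one_le_right (by positivity) (Real.one_le_sqrt.2 (by exact_mod_cast hM))
  have ht : 0 < t := lt_of_lt_of_le (by positivity) hbase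
  have hK : 0 < ⌈t ^ (Fintype.card 𝒴 - 1)⌉₊ := Nat.ceil_pos.2 (by positivity)
  rcases Nat.eq_zero_or_pos (Fintype.card 𝒴 - 1) with hn | hn
  · obtain ⟨Q₀, h1, h2⟩ := hS
    refine ⟨1, fun _ => Q₀, hK, fun _ => ⟨fun y => hη0.le.trans (h1 y), h2⟩,
      fun Q _ hQ => ⟨0, ?_⟩⟩
    have : Subsingleton 𝒴 := Fintype.card_le_one_iff_subsingleton.1 (by omega)
    have hQQ : Q = Q₀ := by
      funext y
      rw [Fintype.sum_subsingleton _ y] at hQ h2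
      rw [hQ, h2]
    simpa [hQQ] using hε.le
  · have hceil : 1 / (η * ε) ≤ (⌈t ^ (Fintype.card 𝒴 - 1)⌉₊ : ℝ) := by
      rcases le_total t 1 with h | h
      · exact (hbase.trans h).trans (by exact_mod_cast hK)
      · exact (hbase.trans (le_self_pow₀ h hn.ne')).trans (Nat.le_ceil _)
    have hbound : η⁻¹ ≤ (⌈t ^ (Fintype.card 𝒴 - 1)⌉₊ : ℝ) * ε :=
      calc η⁻¹ = 1 / (η * ε) * ε := by field_simp
        _ ≤ _ := mul_le_mul_of_nonneg_right hceil hε.le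
    obtain ⟨q, hq, hnet⟩ := exists_net_of_bounded hS (meanCostVec PX ρ d) hε hK fun Q hQ =>
      Set.Icc_subset_Icc_right hbound (meanCostVec_mem_Icc hPX hPX1 hmatch hη0 hQ.1 hQ.2)
    exact ⟨_, q, le_rfl, fun a => ⟨fun y => hη0.le.trans ((hq a).1 y), (hq a).2⟩,
      fun Q h1 h2 => hnet Q ⟨h1, h2⟩⟩
end

section
/- Let η ∈ (0,1) and let U be a mixture of geometric distributions on ℕ₊ with mixing distribution P_X and parameter map p(·) satisfying p(x) ∈ (η,1) for all x. Then log U − E[log U] is a sub-exponential random variable, and there exists a numerical constant C > 0 such that its sub-exponential (Orlicz ψ₁) norm satisfies ‖ log U − E[log U] ‖_{ψ₁} ≤ C / log( 1/(1−η) ). In particular, since log(1/(1−η)) ≥ η, one has ‖ log U − E[log U] ‖_{ψ₁} ≤ C/η. -/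
open MeasureTheory

/-- The sub-exponential (Orlicz `ψ₁`) norm
`‖Z‖_{ψ₁} := inf { s > 0 : E[exp(|Z|/s)] ≤ 2 }`. -/
noncomputable def psi1Norm {Ω : Type*} [MeasurableSpace Ω] (P : Measure Ω)
    (Z : Ω → ℝ) : ℝ :=
  sInf {s : ℝ | 0 < s ∧ ∫⁻ ω, ENNReal.ofReal (Real.exp (|Z ω| / s)) ∂P ≤ 2}

/-- The exponential moment of a shifted geometric distribution, when `(1 - p) b ^ 4 ≤ 1`. -/
theorem tsum_geometric_weight_le {b p : ℝ} (hb : 1 < b) (hp0 : 0 < p) (hp1 : p < 1)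
    (hpb : (1 - p) * b ^ 4 ≤ 1) :
    ∑' n : ℕ, ENNReal.ofReal (b ^ n) * ENNReal.ofReal ((1 - p) ^ n * p)
      ≤ ENNReal.ofReal (4 / 3) := by
  have hq : 0 < 1 - p := by linarith
  have hkey : (1 - p) * (4 * b - 3) ≤ 1 := by
    refine le_trans (mul_le_mul_of_nonneg_left ?_ hq.le) hpb
    nlinarith [mul_nonneg (sq_nonneg (b - 1)) (by positivity : 0 ≤ b ^ 2 + 2 * b + 3)]
  have hr0 : 0 ≤ b * (1 - p) := by positivity
  have hr1 : b * (1 - p) < 1 := by nlinarith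
  have hterm : ∀ n : ℕ, ENNReal.ofReal (b ^ n) * ENNReal.ofReal ((1 - p) ^ n * p)
      = ENNReal.ofReal ((b * (1 - p)) ^ n * p) := fun n ↦ by
    rw [← ENNReal.ofReal_mul (by positivity), mul_pow, mul_assoc]
  simp_rw [hterm]
  have hsum := (hasSum_geometric_of_lt_one hr0 hr1).mul_right p
  rw [← ENNReal.ofReal_tsum_of_nonneg (fun n ↦ by positivity) hsum.summable, hsum.tsum_eq]
  apply ENNReal.ofReal_le_ofReal
  rw [inv_mul_eq_div, div_le_div_iff₀ (by linarith) (by norm_num)]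
  nlinarith

/-- The exponential moment of a shifted mixture of geometric distributions. -/
theorem lintegral_pow_mixture_geometric_le {𝒳 Ω : Type*} [MeasurableSpace 𝒳] [MeasurableSpace Ω]
    {P : Measure Ω} [IsProbabilityMeasure P] {PX : Measure 𝒳} [IsProbabilityMeasure PX]
    {b : ℝ} (hb : 1 < b) {p : 𝒳 → ℝ} (hpm : Measurable p) (hp : ∀ x, p x ∈ Set.Ioo 0 1)
    (hpb : ∀ x, (1 - p x) * b ^ 4 ≤ 1) {V : Ω → ℕ} (hV : Measurable V)
    (hlaw : ∀ n : ℕ, (P {ω | V ω = n}).toReal = ∫ x, (1 - p x) ^ n * p x ∂PX) :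
    ∫⁻ ω, ENNReal.ofReal (b ^ V ω) ∂P ≤ ENNReal.ofReal (4 / 3) := by
  have hnonneg : ∀ (n : ℕ) (x : 𝒳), 0 ≤ (1 - p x) ^ n * p x := fun n x ↦
    mul_nonneg (pow_nonneg (by linarith [(hp x).2]) n) (hp x).1.le
  have hmeas : ∀ n : ℕ, Measurable fun x ↦ (1 - p x) ^ n * p x := fun n ↦ by fun_prop
  have hint : ∀ n : ℕ, Integrable (fun x ↦ (1 - p x) ^ n * p x) PX := fun n ↦ by
    refine Integrable.of_bound (hmeas n).aestronglyMeasurable 1 (Filter.Eventually.of_forall ?_)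
    intro x
    rw [Real.norm_of_nonneg (hnonneg n x)]
    exact mul_le_one₀ (pow_le_one₀ (by linarith [(hp x).2]) (by linarith [(hp x).1]))
      (hp x).1.le (hp x).2.le
  have hprob : ∀ n : ℕ, P.map V {n} = ∫⁻ x, ENNReal.ofReal ((1 - p x) ^ n * p x) ∂PX := fun n ↦ by
    rw [Measure.map_apply hV (measurableSet_singleton n),
      ← ofReal_integral_eq_lintegral_ofReal (hint n) (Filter.Eventually.of_forall (hnonneg n)),
      ← hlaw n, ENNReal.ofReal_toReal (measure_ne_top _ _)]
    rfl
  rw [← lintegral_map (f := fun n : ℕ ↦ ENNReal.ofReal (b ^ n)) (by fun_prop) hV,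
    lintegral_countable']
  simp_rw [hprob]
  calc ∑' n : ℕ, ENNReal.ofReal (b ^ n) * ∫⁻ x, ENNReal.ofReal ((1 - p x) ^ n * p x) ∂PX
      = ∑' n : ℕ, ∫⁻ x, ENNReal.ofReal (b ^ n) * ENNReal.ofReal ((1 - p x) ^ n * p x) ∂PX := by
        congr 1 with n
        rw [lintegral_const_mul _ (hmeas n).ennreal_ofReal]
    _ = ∫⁻ x, ∑' n : ℕ, ENNReal.ofReal (b ^ n) * ENNReal.ofReal ((1 - p x) ^ n * p x) ∂PX :=
        (lintegral_tsum fun n ↦ ((hmeas n).ennreal_ofReal.const_mul _).aemeasurable).symm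
    _ ≤ ∫⁻ _, ENNReal.ofReal (4 / 3) ∂PX :=
        lintegral_mono fun x ↦ tsum_geometric_weight_le hb (hp x).1 (hp x).2 (hpb x)
    _ = ENNReal.ofReal (4 / 3) := by simp

/-- A bound on the exponential moment of a nonnegative variable gives one for its centering. -/
theorem lintegral_exp_abs_sub_integral_le_two {Ω : Type*} [MeasurableSpace Ω] {P : Measure Ω}
    [IsProbabilityMeasure P] {Y : Ω → ℝ} {s : ℝ} (hs : 0 < s) (hYm : Measurable Y)
    (hY : ∀ ω, 0 ≤ Y ω)
    (hexp : ∫⁻ ω, ENNReal.ofReal (Real.exp (Y ω / s)) ∂P ≤ ENNReal.ofReal (4 / 3)) :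
    ∫⁻ ω, ENNReal.ofReal (Real.exp (|Y ω - ∫ ω', Y ω' ∂P| / s)) ∂P ≤ 2 := by
  have hint : Integrable (fun ω ↦ Real.exp (Y ω / s)) P := by
    refine ⟨by fun_prop, ?_⟩
    rw [hasFiniteIntegral_iff_ofReal (Filter.Eventually.of_forall fun ω ↦ (Real.exp_pos _).le)]
    exact hexp.trans_lt ENNReal.ofReal_lt_top
  have hexp' : ∫ ω, Real.exp (Y ω / s) ∂P ≤ 4 / 3 := by
    rw [← ofReal_integral_eq_lintegral_ofReal hint
      (Filter.Eventually.of_forall fun ω ↦ (Real.exp_pos _).le)] at hexp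
    exact (ENNReal.ofReal_le_ofReal_iff (by norm_num)).1 hexp
  set m := ∫ ω, Y ω ∂P with hm
  have hm0 : 0 ≤ m := integral_nonneg hY
  have hms : m / s ≤ 1 / 3 := by
    calc m / s = ∫ ω, Y ω / s ∂P := (integral_div s Y).symm
      _ ≤ ∫ ω, (Real.exp (Y ω / s) - 1) ∂P := by
        refine integral_mono_of_nonneg
          (Filter.Eventually.of_forall fun ω ↦ div_nonneg (hY ω) hs.le)
          (hint.sub (integrable_const 1)) (Filter.Eventually.of_forall fun ω ↦ ?_)
        simpa using le_sub_iff_add_le.2 (Real.add_one_le_exp (Y ω / s))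
      _ ≤ 1 / 3 := by
        rw [integral_sub hint (integrable_const 1)]
        simp only [integral_const, probReal_univ, smul_eq_mul]
        linarith
  have hexpm : Real.exp (m / s) ≤ 3 / 2 := by
    have h := Real.add_one_le_exp (-(m / s))
    have h' : Real.exp (-(m / s)) * Real.exp (m / s) = 1 := by rw [← Real.exp_add]; simp
    nlinarith [Real.exp_pos (m / s)]
  calc ∫⁻ ω, ENNReal.ofReal (Real.exp (|Y ω - m| / s)) ∂P
      ≤ ∫⁻ ω, ENNReal.ofReal (3 / 2) * ENNReal.ofReal (Real.exp (Y ω / s)) ∂P := by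
        refine lintegral_mono fun ω ↦ ?_
        rw [← ENNReal.ofReal_mul (by norm_num)]
        apply ENNReal.ofReal_le_ofReal
        calc Real.exp (|Y ω - m| / s) ≤ Real.exp (m / s + Y ω / s) := by
              rw [← add_div]
              gcongr
              exact abs_le.2 ⟨by linarith [hY ω], by linarith⟩
          _ = Real.exp (m / s) * Real.exp (Y ω / s) := Real.exp_add _ _
          _ ≤ 3 / 2 * Real.exp (Y ω / s) := by gcongr
    _ = ENNReal.ofReal (3 / 2) * ∫⁻ ω, ENNReal.ofReal (Real.exp (Y ω / s)) ∂P :=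
        lintegral_const_mul _ (by fun_prop)
    _ ≤ ENNReal.ofReal (3 / 2) * ENNReal.ofReal (4 / 3) := by gcongr
    _ = 2 := by
        rw [← ENNReal.ofReal_mul (by norm_num)]
        norm_num


/-- if `U` is a mixture of Geometric distributions on `ℕ₊` with all mixing
parameters in `(η,1)`, then `log U − E[log U]` is sub-exponential, with
`‖log U − E[log U]‖_{ψ₁} ≤ C / log(1/(1−η)) ≤ C/η` for a numerical constant `C > 0`. -/
theorem stmt15 : ∃ C : ℝ, 0 < C ∧
    ∀ (𝒳 Ω : Type) (_ : MeasurableSpace 𝒳) (_ : MeasurableSpace Ω)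
      (P : Measure Ω) (_ : IsProbabilityMeasure P)
      (PX : Measure 𝒳) (_ : IsProbabilityMeasure PX)
      (η : ℝ), η ∈ Set.Ioo (0:ℝ) 1 →
      ∀ (p : 𝒳 → ℝ), Measurable p → (∀ x, p x ∈ Set.Ioo η 1) →
      ∀ (U : Ω → ℕ), Measurable U → (∀ ω, 1 ≤ U ω) →
      (∀ u : ℕ, 1 ≤ u →
        (P {ω | U ω = u}).toReal = ∫ x, (1 - p x) ^ (u - 1) * p x ∂PX) →
      -- `log U − E[log U]` is sub-exponential (its `ψ₁` set is nonempty) …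
      {s : ℝ | 0 < s ∧ ∫⁻ ω, ENNReal.ofReal
          (Real.exp (|Real.log (U ω) - ∫ ω', Real.log (U ω') ∂P| / s)) ∂P ≤ 2}.Nonempty
      -- … and its `ψ₁` norm is at most `C / log(1/(1−η)) ≤ C / η`
      ∧ psi1Norm P (fun ω => Real.log (U ω) - ∫ ω', Real.log (U ω') ∂P)
          ≤ C / Real.log (1 / (1 - η))
      ∧ psi1Norm P (fun ω => Real.log (U ω) - ∫ ω', Real.log (U ω') ∂P) ≤ C / η := by
  refine ⟨4, by norm_num, ?_⟩
  intro 𝒳 Ω _ _ P _ PX _ η hη p hpm hp U hU hU1 hlaw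
  have hη1 : 0 < 1 - η := by linarith [hη.2]
  set L := Real.log (1 / (1 - η)) with hL
  have hLη : η ≤ L := by
    have h := Real.log_le_sub_one_of_pos hη1
    rw [hL, one_div, Real.log_inv]
    linarith
  have hL0 : 0 < L := hη.1.trans_le hLη
  set b := Real.exp (L / 4) with hb
  have hb1 : 1 < b := Real.one_lt_exp_iff.2 (by positivity)
  have hb4 : b ^ 4 = 1 / (1 - η) := by
    rw [hb, ← Real.exp_nat_mul, ← Real.exp_log (show 0 < 1 / (1 - η) by positivity), ← hL]
    congr 1
    push_cast
    ring
  have hmoment : ∫⁻ ω, ENNReal.ofReal (b ^ (U ω - 1)) ∂P ≤ ENNReal.ofReal (4 / 3) := by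
    refine lintegral_pow_mixture_geometric_le (PX := PX) hb1 hpm
      (fun x ↦ ⟨hη.1.trans (hp x).1, (hp x).2⟩) (fun x ↦ ?_) (by fun_prop) (fun n ↦ ?_)
    · rw [hb4, mul_one_div, div_le_one hη1]
      linarith [(hp x).1]
    · rw [← Nat.add_sub_cancel (n := n) (m := 1), ← hlaw (n + 1) (by omega), Nat.add_sub_cancel]
      congr 2 with ω
      have := hU1 ω
      simp only [Set.mem_ofPred_eq]
      omega
  have hlog : ∫⁻ ω, ENNReal.ofReal (Real.exp (Real.log (U ω) / (4 / L))) ∂P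
      ≤ ENNReal.ofReal (4 / 3) := by
    refine (lintegral_mono fun ω ↦ ENNReal.ofReal_le_ofReal ?_).trans hmoment
    have hpos : (0 : ℝ) < U ω := by exact_mod_cast hU1 ω
    rw [hb, ← Real.exp_nat_mul, Nat.cast_sub (hU1 ω), Real.exp_le_exp, div_div_eq_mul_div,
      mul_div_assoc]
    push_cast
    gcongr
    exact Real.log_le_sub_one_of_pos hpos
  have hmem : 4 / L ∈ {s : ℝ | 0 < s ∧ ∫⁻ ω, ENNReal.ofReal
      (Real.exp (|Real.log (U ω) - ∫ ω', Real.log (U ω') ∂P| / s)) ∂P ≤ 2} := by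
    refine ⟨by positivity, lintegral_exp_abs_sub_integral_le_two (by positivity) ?_
      (fun ω ↦ Real.log_natCast_nonneg _) hlog⟩
    fun_prop
  have hnorm : psi1Norm P (fun ω => Real.log (U ω) - ∫ ω', Real.log (U ω') ∂P) ≤ 4 / L :=
    csInf_le ⟨0, fun s hs ↦ hs.1.le⟩ hmem
  exact ⟨⟨_, hmem⟩, hnorm, hnorm.trans (div_le_div_of_nonneg_left (by norm_num) hη.1 hLη)⟩
end
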